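/- Let λ ∈ ℚ ∩ (1/√2, 1) and n > 2 with λⁿ < 1/3. Define the planar IFS Φ = {φ_u}_{u∈{0,1}ⁿ} by: φ_{0⋯0}(x,y) = (λⁿx + ψ_{1⋯1}(0), λⁿy), φ_{1⋯1}(x,y) = (λⁿx, λⁿy + ψ_{1⋯1}(0)), and φ_u(x,y) = (λⁿx + ψ_u(0), λⁿy + ψ_u(0)) otherwise, where ψ₀(x) = λx, ψ₁(x) = λx + 1, and ψ_u denotes composition along the word u. Let μ be the self-affine measure for Φ with the uniform probability vector on {0,1}ⁿ. Then dim μ ≤ 1 + log 3/(−n log λ) < 2 = min{2, log 2/(−log λ)}. -/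

import Mathlib

open MeasureTheory Topology Filter

/-- `ψ_u(0)` for the word `u` over the IFS `ψ₀(x) = λx`, `ψ₁(x) = λx + 1` on `ℝ`. -/
noncomputable def psiVal (l : ℝ) {n : ℕ} (u : Fin n → Bool) : ℝ :=
  ∑ k : Fin n, l ^ (k : ℕ) * (if u k then (1 : ℝ) else 0)

/-- The planar map `φ_u` of the example: `φ_{0⋯0}(x,y) = (λⁿx + ψ_{1⋯1}(0), λⁿy)`,
`φ_{1⋯1}(x,y) = (λⁿx, λⁿy + ψ_{1⋯1}(0))`, and `φ_u(x,y) = (λⁿx + ψ_u(0), λⁿy + ψ_u(0))`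
otherwise. -/
noncomputable def examplePhi (l : ℝ) (n : ℕ) (u : Fin n → Bool) (p : ℝ × ℝ) : ℝ × ℝ :=
  if u = (fun _ => false) then
    (l ^ n * p.1 + psiVal l (fun _ : Fin n => true), l ^ n * p.2)
  else if u = (fun _ => true) then
    (l ^ n * p.1, l ^ n * p.2 + psiVal l (fun _ : Fin n => true))
  else
    (l ^ n * p.1 + psiVal l u, l ^ n * p.2 + psiVal l u)

/-- If `μ` is the uniform average of its images under the maps `f u`, then any common bound on the
measures of the preimages of a measurable set bounds the measure of that set. -/
lemma measure_le_of_preimage_le {X ι : Type*} [MeasurableSpace X] [Fintype ι] {μ : Measure X}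
    {w : ENNReal} (hw : (Fintype.card ι : ENNReal) * w ≤ 1) {f : ι → X → X}
    (hf : ∀ u, Measurable (f u)) (hself : μ = ∑ u, w • Measure.map (f u) μ)
    {S : Set X} (hS : MeasurableSet S) {b : ENNReal} (hb : ∀ u, μ (f u ⁻¹' S) ≤ b) :
    μ S ≤ b := by
  have h : μ S = ∑ u, w * μ (f u ⁻¹' S) := by
    conv_lhs => rw [hself]
    simp [Measure.finsetSum_apply, Measure.map_apply (hf _) hS]
  calc μ S = ∑ u, w * μ (f u ⁻¹' S) := h
    _ ≤ ∑ _u : ι, w * b := Finset.sum_le_sum fun u _ => by gcongr; exact hb u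
    _ = (Fintype.card ι * w) * b := by simp [mul_assoc]
    _ ≤ 1 * b := by gcongr
    _ = b := one_mul b

/-- A finite measure that is a uniform average of its images under uniformly contracting maps is
carried by a bounded set. -/
lemma exists_ae_norm_le {X ι : Type*} [NormedAddCommGroup X] [MeasurableSpace X] [BorelSpace X]
    [Fintype ι] {μ : Measure X} [IsFiniteMeasure μ]
    {w : ENNReal} (hw : (Fintype.card ι : ENNReal) * w ≤ 1) {f : ι → X → X}
    (hf : ∀ u, Measurable (f u)) (hself : μ = ∑ u, w • Measure.map (f u) μ)
    {ρ c : ℝ} (hρ0 : 0 < ρ) (hρ1 : ρ < 1) (hc : 0 ≤ c)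
    (hcontr : ∀ u x, ‖f u x‖ ≤ ρ * ‖x‖ + c) :
    ∃ R : ℝ, 0 ≤ R ∧ ∀ᵐ x ∂μ, ‖x‖ ≤ R := by
  have hmeas : ∀ t : ℝ, MeasurableSet {x : X | t < ‖x‖} := fun t =>
    measurableSet_lt measurable_const measurable_norm
  set t : ℕ → ℝ := fun j => c / (1 - ρ) + (ρ⁻¹) ^ j with ht
  have hstep : ∀ j, μ {x | t j < ‖x‖} ≤ μ {x | t (j + 1) < ‖x‖} := by
    intro j
    refine measure_le_of_preimage_le hw hf hself (hmeas _) fun u => measure_mono ?_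
    intro x hx
    have h1 : t j < ‖f u x‖ := hx
    have h2 := hcontr u x
    have h3 : ρ * t (j + 1) + c = t j := by
      have : 1 - ρ ≠ 0 := by linarith
      simp only [ht, pow_succ]
      field_simp
      ring
    have h4 : ρ * t (j + 1) < ρ * ‖x‖ := by linarith
    exact lt_of_mul_lt_mul_left h4 hρ0.le
  have hle : ∀ j, μ {x | t 0 < ‖x‖} ≤ μ {x | t j < ‖x‖} := by
    intro j
    induction j with
    | zero => exact le_rfl
    | succ j ih => exact ih.trans (hstep j)
  have hone : 1 < ρ⁻¹ := (one_lt_inv₀ hρ0).2 hρ1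
  have hmono : Monotone t := fun i j hij =>
    add_le_add le_rfl (pow_le_pow_right₀ hone.le hij)
  have hlim : Tendsto (fun j => μ {x : X | t j < ‖x‖}) atTop (𝓝 0) := by
    have hempty : ⋂ j, {x : X | t j < ‖x‖} = ∅ := by
      refine Set.eq_empty_of_forall_notMem fun x hx => ?_
      obtain ⟨j, hj⟩ := pow_unbounded_of_one_lt ‖x‖ hone
      have h1 : t j < ‖x‖ := Set.mem_iInter.1 hx j
      have h2 : 0 ≤ c / (1 - ρ) := div_nonneg hc (by linarith)
      simp only [ht] at h1
      linarith
    have := tendsto_measure_iInter_atTop (μ := μ) (s := fun j => {x : X | t j < ‖x‖})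
      (fun j => (hmeas _).nullMeasurableSet)
      (fun i j hij x hx => lt_of_le_of_lt (hmono hij) hx) ⟨0, measure_ne_top _ _⟩
    rwa [hempty, measure_empty] at this
  refine ⟨t 0, add_nonneg (div_nonneg hc (by linarith)) (by simp), ?_⟩
  have hzero : μ {x | t 0 < ‖x‖} = 0 := le_antisymm (ge_of_tendsto' hlim hle) bot_le
  rw [ae_iff]
  simpa using hzero

/-- If at every scale `a * ρ ^ k` a full measure set is covered by at most `C * β ^ k` sets of
diameter at most `a * ρ ^ k`, then the exact dimension is at most `log β / (-log ρ)`. -/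
lemma dim_le_of_covers {X : Type*} [PseudoMetricSpace X] [MeasurableSpace X] {μ : Measure X}
    [IsProbabilityMeasure μ] {D ρ a C β : ℝ} (hρ0 : 0 < ρ) (hρ1 : ρ < 1) (ha : 0 < a)
    (hβ : 0 < β)
    (hcover : ∀ k : ℕ, ∃ (ι : Type) (F : Finset ι) (Q : ι → Set X),
      (F.card : ℝ) ≤ C * β ^ k ∧ (∀ᵐ p ∂μ, ∃ i ∈ F, p ∈ Q i) ∧
      ∀ i, ∀ p ∈ Q i, ∀ q ∈ Q i, dist q p ≤ a * ρ ^ k)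
    (hdim : ∀ᵐ p ∂μ, Tendsto
      (fun r => Real.log ((μ (Metric.closedBall p r)).toReal) / Real.log r)
      (𝓝[>] (0 : ℝ)) (𝓝 D)) :
    D ≤ Real.log β / (-Real.log ρ) := by
  by_contra! hD
  obtain ⟨d, hd1, hd2⟩ := exists_between hD
  have hlogρ : Real.log ρ < 0 := Real.log_neg hρ0 hρ1
  set θ : ℝ := β * ρ ^ d with hθ
  have hρd : 0 < ρ ^ d := Real.rpow_pos_of_pos hρ0 d
  have hθ0 : 0 < θ := mul_pos hβ hρd
  have hθ1 : θ < 1 := by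
    rw [div_lt_iff₀ (by linarith)] at hd1
    rw [← Real.log_neg_iff hθ0, hθ, Real.log_mul hβ.ne' hρd.ne', Real.log_rpow hρ0]
    linarith
  set A : ℕ → Set X := fun k =>
    {p | (μ (Metric.closedBall p (a * ρ ^ k))).toReal ≤ (a * ρ ^ k) ^ d}
  have hscale : ∀ k : ℕ, 0 < a * ρ ^ k := fun k => mul_pos ha (pow_pos hρ0 k)
  have hAmeas : ∀ k, μ (A k) ≤ ENNReal.ofReal (C * a ^ d * θ ^ k) := by
    classical
    intro k
    obtain ⟨ι, F, Q, hcard, hae, hdiam⟩ := hcover k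
    have hcell : ∀ i, μ (A k ∩ Q i) ≤ ENNReal.ofReal ((a * ρ ^ k) ^ d) := by
      intro i
      rcases (A k ∩ Q i).eq_empty_or_nonempty with h | ⟨p, hpA, hpQ⟩
      · simp [h]
      · calc μ (A k ∩ Q i) ≤ μ (Metric.closedBall p (a * ρ ^ k)) :=
              measure_mono fun q hq => hdiam i p hpQ q hq.2
          _ ≤ _ := by
              rw [← ENNReal.ofReal_toReal (measure_ne_top μ _)]
              exact ENNReal.ofReal_le_ofReal hpA
    have hpow : (F.card : ℝ) * (a * ρ ^ k) ^ d ≤ C * a ^ d * θ ^ k := by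
      have h1 : (a * ρ ^ k) ^ d = a ^ d * (ρ ^ d) ^ k := by
        rw [Real.mul_rpow ha.le (pow_pos hρ0 k).le, ← Real.rpow_natCast, ← Real.rpow_natCast,
          ← Real.rpow_mul hρ0.le, ← Real.rpow_mul hρ0.le, mul_comm d]
      calc (F.card : ℝ) * (a * ρ ^ k) ^ d ≤ (C * β ^ k) * (a * ρ ^ k) ^ d :=
            mul_le_mul_of_nonneg_right hcard (Real.rpow_nonneg (hscale k).le d)
        _ = C * a ^ d * θ ^ k := by rw [h1, hθ, mul_pow]; ring
    calc μ (A k) ≤ μ (⋃ i ∈ F, A k ∩ Q i) := by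
          refine measure_mono_ae ?_
          filter_upwards [hae] with p hp hpA
          obtain ⟨i, hi, hpi⟩ := hp
          exact Set.mem_biUnion hi ⟨hpA, hpi⟩
      _ ≤ ∑ i ∈ F, μ (A k ∩ Q i) := measure_biUnion_finset_le F _
      _ ≤ ∑ _i ∈ F, ENNReal.ofReal ((a * ρ ^ k) ^ d) := Finset.sum_le_sum fun i _ => hcell i
      _ = ENNReal.ofReal (F.card * (a * ρ ^ k) ^ d) := by
          rw [Finset.sum_const, nsmul_eq_mul, ENNReal.ofReal_mul (by positivity),
            ENNReal.ofReal_natCast]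
      _ ≤ _ := ENNReal.ofReal_le_ofReal hpow
  have hsum : ∑' k, μ (A k) ≠ ⊤ := by
    have hs : Summable fun k : ℕ => C * a ^ d * θ ^ k :=
      (summable_geometric_of_lt_one hθ0.le hθ1).mul_left _
    exact ne_top_of_le_ne_top hs.tsum_ofReal_ne_top (ENNReal.tsum_le_tsum hAmeas)
  have hnot : ∀ᵐ p ∂μ, ∀ᶠ k in atTop, p ∉ A k := ae_eventually_notMem hsum
  have hr0 : Tendsto (fun k : ℕ => a * ρ ^ k) atTop (𝓝 0) := by
    simpa using (tendsto_pow_atTop_nhds_zero_of_lt_one hρ0.le hρ1).const_mul a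
  have hr : Tendsto (fun k : ℕ => a * ρ ^ k) atTop (𝓝[>] 0) :=
    tendsto_nhdsWithin_iff.2 ⟨hr0, Eventually.of_forall hscale⟩
  have hmem : ∀ᵐ p ∂μ, ∀ᶠ k in atTop, p ∈ A k := by
    filter_upwards [hdim] with p hp
    filter_upwards [(hp.comp hr).eventually (lt_mem_nhds hd2), hr0.eventually (gt_mem_nhds one_pos)]
      with k hk hk1
    have hlog : Real.log (a * ρ ^ k) < 0 := Real.log_neg (hscale k) hk1
    simp only [Function.comp_apply] at hk
    rw [lt_div_iff_of_neg hlog] at hk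
    change (μ (Metric.closedBall p (a * ρ ^ k))).toReal ≤ (a * ρ ^ k) ^ d
    rcases (ENNReal.toReal_nonneg (a := μ (Metric.closedBall p (a * ρ ^ k)))).eq_or_lt' with h0 | h0
    · rw [h0]
      exact Real.rpow_nonneg (hscale k).le d
    · rw [← Real.log_le_log_iff h0 (Real.rpow_pos_of_pos (hscale k) d), Real.log_rpow (hscale k)]
      exact hk.le
  obtain ⟨p, hp1, hp2⟩ := (hnot.and hmem).exists
  obtain ⟨k, hk1, hk2⟩ := (hp1.and hp2).exists
  exact hk1 hk2

/-- The centers of level `k` of the Cantor set generated by `t ↦ ρ * t + s`, `s ∈ {c, -c, 0}`. -/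
noncomputable def cantorCenters (ρ c : ℝ) : ℕ → Finset ℝ
  | 0 => {0}
  | k + 1 => (cantorCenters ρ c k ×ˢ ({c, -c, 0} : Finset ℝ)).image fun q => ρ * q.1 + q.2

lemma card_cantorCenters_le (ρ c : ℝ) (k : ℕ) : (cantorCenters ρ c k).card ≤ 3 ^ k := by
  induction k with
  | zero => simp [cantorCenters]
  | succ k ih =>
    refine Finset.card_image_le.trans ?_
    rw [Finset.card_product, pow_succ]
    exact Nat.mul_le_mul ih Finset.card_le_three

lemma psiVal_nonneg {l : ℝ} (hl : 0 ≤ l) {n : ℕ} (u : Fin n → Bool) : 0 ≤ psiVal l u :=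
  Finset.sum_nonneg fun k _ => by positivity

lemma psiVal_le {l : ℝ} (hl : 0 ≤ l) {n : ℕ} (u : Fin n → Bool) :
    psiVal l u ≤ psiVal l (fun _ : Fin n => true) := by
  refine Finset.sum_le_sum fun k _ => ?_
  have := pow_nonneg hl (k : ℕ)
  cases u k <;> simp [this]

lemma measurable_examplePhi (l : ℝ) (n : ℕ) (u : Fin n → Bool) :
    Measurable (examplePhi l n u) := by
  unfold examplePhi
  split_ifs <;> fun_prop

lemma norm_examplePhi_le {l : ℝ} (hl : 0 ≤ l) (n : ℕ) (u : Fin n → Bool) (p : ℝ × ℝ) :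
    ‖examplePhi l n u p‖ ≤ l ^ n * ‖p‖ + psiVal l (fun _ : Fin n => true) := by
  have hρ : 0 ≤ l ^ n := pow_nonneg hl n
  have hmain : ∀ s x : ℝ, |x| ≤ ‖p‖ → 0 ≤ s → s ≤ psiVal l (fun _ : Fin n => true) →
      |l ^ n * x + s| ≤ l ^ n * ‖p‖ + psiVal l (fun _ : Fin n => true) := by
    intro s x hx hs0 hs
    calc |l ^ n * x + s| ≤ |l ^ n * x| + |s| := abs_add_le _ _
      _ = l ^ n * |x| + s := by rw [abs_mul, abs_of_nonneg hρ, abs_of_nonneg hs0]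
      _ ≤ _ := add_le_add (mul_le_mul_of_nonneg_left hx hρ) hs
  have h1 : |p.1| ≤ ‖p‖ := norm_fst_le p
  have h2 : |p.2| ≤ ‖p‖ := norm_snd_le p
  have hc := psiVal_nonneg hl (fun _ : Fin n => true)
  unfold examplePhi
  split_ifs
  · exact max_le (hmain _ _ h1 hc le_rfl) (by simpa using hmain 0 _ h2 le_rfl hc)
  · exact max_le (by simpa using hmain 0 _ h1 le_rfl hc) (hmain _ _ h2 hc le_rfl)
  · exact max_le (hmain _ _ h1 (psiVal_nonneg hl u) (psiVal_le hl u))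
      (hmain _ _ h2 (psiVal_nonneg hl u) (psiVal_le hl u))

/-- The maps of the example act on the difference of the coordinates through three maps only. -/
lemma examplePhi_fst_sub_snd (l : ℝ) (n : ℕ) (u : Fin n → Bool) :
    ∃ s ∈ ({psiVal l (fun _ : Fin n => true), -psiVal l (fun _ : Fin n => true), 0} : Finset ℝ),
      ∀ p, (examplePhi l n u p).1 - (examplePhi l n u p).2 = l ^ n * (p.1 - p.2) + s := by
  unfold examplePhi
  split_ifs
  · exact ⟨psiVal l (fun _ : Fin n => true), by simp, fun p => by dsimp only; ring⟩
  · exact ⟨-psiVal l (fun _ : Fin n => true), by simp, fun p => by dsimp only; ring⟩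
  · exact ⟨0, by simp, fun p => by dsimp only; ring⟩

/-- Up to a null set, the difference of the coordinates is `R * (l ^ n) ^ k`-close to the
centers of level `k`. -/
lemma ae_near_cantorCenters {l : ℝ} (hl : 0 ≤ l) {n : ℕ} {μ : Measure (ℝ × ℝ)}
    (hself : μ = ∑ u : Fin n → Bool,
      (((2 : ENNReal) ^ n)⁻¹) • Measure.map (examplePhi l n u) μ)
    {R : ℝ} (hR : ∀ᵐ p ∂μ, |p.1 - p.2| ≤ R) (k : ℕ) :
    ∀ᵐ p ∂μ, ∃ e ∈ cantorCenters (l ^ n) (psiVal l (fun _ : Fin n => true)) k,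
      |p.1 - p.2 - e| ≤ R * (l ^ n) ^ k := by
  have hρ : 0 ≤ l ^ n := pow_nonneg hl n
  induction k with
  | zero => simpa [cantorCenters] using hR
  | succ k ih =>
    set c := psiVal l (fun _ : Fin n => true)
    have hS : MeasurableSet {p : ℝ × ℝ | ¬ ∃ e ∈ cantorCenters (l ^ n) c (k + 1),
        |p.1 - p.2 - e| ≤ R * (l ^ n) ^ (k + 1)} := by
      have : {p : ℝ × ℝ | ¬ ∃ e ∈ cantorCenters (l ^ n) c (k + 1),
          |p.1 - p.2 - e| ≤ R * (l ^ n) ^ (k + 1)} =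
          (⋃ e ∈ cantorCenters (l ^ n) c (k + 1),
            {p : ℝ × ℝ | |p.1 - p.2 - e| ≤ R * (l ^ n) ^ (k + 1)})ᶜ := by
        ext p
        simp
      rw [this]
      refine (Finset.measurableSet_biUnion _ fun e _ => ?_).compl
      exact (isClosed_le (by fun_prop) continuous_const).measurableSet
    refine le_antisymm (measure_le_of_preimage_le (by simp [ENNReal.mul_inv_cancel])
      (measurable_examplePhi l n) hself hS fun u => ?_) bot_le
    refine le_of_eq (measure_mono_null ?_ ih)
    intro p hp hp'
    obtain ⟨e, he, hpe⟩ := hp'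
    obtain ⟨s, hs, hus⟩ := examplePhi_fst_sub_snd l n u
    refine hp ⟨l ^ n * e + s, Finset.mem_image.2 ⟨(e, s), Finset.mk_mem_product he hs, rfl⟩, ?_⟩
    rw [hus p, show l ^ n * (p.1 - p.2) + s - (l ^ n * e + s) = l ^ n * (p.1 - p.2 - e) by ring,
      abs_mul, abs_of_nonneg hρ, pow_succ]
    nlinarith [mul_le_mul_of_nonneg_left hpe hρ]

lemma floor_mem_Icc_of_abs_le {x B : ℝ} (h : |x| ≤ B) :
    ⌊x⌋ ∈ Finset.Icc (-⌈B⌉) ⌈B⌉ := by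
  rw [abs_le] at h
  rw [Finset.mem_Icc]
  constructor
  · rw [Int.le_floor]
    push_cast
    linarith [Int.le_ceil B, h.1]
  · exact_mod_cast (Int.floor_le x).trans (h.2.trans (Int.le_ceil B))

lemma card_Icc_ceil_le {B : ℝ} (hB : 0 ≤ B) :
    ((Finset.Icc (-⌈B⌉) ⌈B⌉).card : ℝ) ≤ 2 * B + 3 := by
  have h0 : 0 ≤ ⌈B⌉ := Int.ceil_nonneg hB
  rw [Int.card_Icc, show ((⌈B⌉ + 1 - -⌈B⌉).toNat : ℝ) = ((⌈B⌉ + 1 - -⌈B⌉).toNat : ℤ)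
    from (Int.cast_natCast _).symm,
    Int.toNat_of_nonneg (by omega)]
  push_cast
  linarith [Int.ceil_lt_add_one B]

lemma abs_sub_le_of_floor_div_eq {x y z δ : ℝ} (hδ : 0 < δ) (h : ⌊(x - z) / δ⌋ = ⌊(y - z) / δ⌋) :
    |x - y| ≤ δ := by
  have h1 := Int.abs_sub_lt_one_of_floor_eq_floor h
  rw [← sub_div, abs_div, abs_of_pos hδ, div_lt_one hδ] at h1
  simpa using h1.le

/-- A planar measure on a bounded set whose difference of coordinates is `R * δ`-close to a finite
set `E` is carried by at most a constant times `E.card / δ` sets of diameter at most `2 * δ`. -/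
lemma exists_cells {μ : Measure (ℝ × ℝ)} {R δ : ℝ} (hR0 : 0 ≤ R) (hδ : 0 < δ) (hδ1 : δ ≤ 1)
    (hR : ∀ᵐ p ∂μ, ‖p‖ ≤ R) {E : Finset ℝ}
    (hE : ∀ᵐ p ∂μ, ∃ e ∈ E, |p.1 - p.2 - e| ≤ 2 * R * δ) :
    ∃ (ι : Type) (F : Finset ι) (Q : ι → Set (ℝ × ℝ)),
      (F.card : ℝ) ≤ (2 * R + 3) * (4 * R + 3) * (E.card / δ) ∧
      (∀ᵐ p ∂μ, ∃ i ∈ F, p ∈ Q i) ∧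
      ∀ i, ∀ p ∈ Q i, ∀ q ∈ Q i, dist q p ≤ 2 * δ := by
  refine ⟨ℝ × ℤ × ℤ,
    E ×ˢ Finset.Icc (-⌈R / δ⌉) ⌈R / δ⌉ ×ˢ Finset.Icc (-⌈2 * R⌉) ⌈2 * R⌉,
    fun i => {p | ⌊(p.1 - 0) / δ⌋ = i.2.1 ∧ ⌊(p.1 - p.2 - i.1) / δ⌋ = i.2.2}, ?_, ?_, ?_⟩
  · rw [Finset.card_product, Finset.card_product]
    push_cast
    have h1 : ((Finset.Icc (-⌈R / δ⌉) ⌈R / δ⌉).card : ℝ) ≤ (2 * R + 3) / δ := by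
      refine (card_Icc_ceil_le (by positivity)).trans ?_
      rw [add_div, mul_div_assoc]
      gcongr
      rw [le_div_iff₀ hδ]
      linarith
    have h2 : ((Finset.Icc (-⌈2 * R⌉) ⌈2 * R⌉).card : ℝ) ≤ 4 * R + 3 :=
      (card_Icc_ceil_le (by positivity)).trans (by linarith)
    calc (E.card : ℝ) * ((Finset.Icc (-⌈R / δ⌉) ⌈R / δ⌉).card *
          (Finset.Icc (-⌈2 * R⌉) ⌈2 * R⌉).card)
        ≤ E.card * ((2 * R + 3) / δ * (4 * R + 3)) := by gcongr
      _ = _ := by ring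
  · filter_upwards [hR, hE] with p hp ⟨e, he, hpe⟩
    refine ⟨(e, ⌊(p.1 - 0) / δ⌋, ⌊(p.1 - p.2 - e) / δ⌋), ?_, rfl, rfl⟩
    refine Finset.mk_mem_product he (Finset.mk_mem_product ?_ ?_)
    · refine floor_mem_Icc_of_abs_le ?_
      rw [abs_div, abs_of_pos hδ, sub_zero]
      gcongr
      exact (norm_fst_le p).trans hp
    · refine floor_mem_Icc_of_abs_le ?_
      rwa [abs_div, abs_of_pos hδ, div_le_iff₀ hδ]
  · rintro ⟨e, a, b⟩ p ⟨hp1, hp2⟩ q ⟨hq1, hq2⟩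
    have h1 := abs_le.1 (abs_sub_le_of_floor_div_eq hδ (hq1.trans hp1.symm))
    have h2 := abs_le.1 (abs_sub_le_of_floor_div_eq hδ (hq2.trans hp2.symm))
    rw [Prod.dist_eq, Real.dist_eq, Real.dist_eq]
    refine max_le (abs_le.2 ⟨?_, ?_⟩) (abs_le.2 ⟨?_, ?_⟩) <;> linarith

/-- For rational `λ ∈ (1/√2, 1)` and `n > 2` with `λⁿ < 1/3`, the self-affine measure of
the example satisfies `dim μ ≤ 1 + log 3 / (−n log λ) < 2 = min{2, log 2/(−log λ)}`. -/
theorem example_dim_lt_lyapunov (l : ℝ) (hrat : ∃ q : ℚ, (q : ℝ) = l)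
    (hl1 : 1 / Real.sqrt 2 < l) (hl2 : l < 1) (n : ℕ) (hn : 2 < n)
    (hln : l ^ n < 1 / 3)
    (μ : Measure (ℝ × ℝ)) [MeasureTheory.IsProbabilityMeasure μ]
    (hself : μ = ∑ u : Fin n → Bool,
      (((2 : ENNReal) ^ n)⁻¹) • Measure.map (examplePhi l n u) μ)
    (D : ℝ)
    (hdim : ∀ᵐ p ∂μ, Tendsto
      (fun r => Real.log ((μ (Metric.closedBall p r)).toReal) / Real.log r)
      (𝓝[>] (0 : ℝ)) (𝓝 D)) :
    D ≤ 1 + Real.log 3 / (-(n * Real.log l)) ∧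
      1 + Real.log 3 / (-(n * Real.log l)) < 2 ∧
      (2 : ℝ) = min 2 (Real.log 2 / (-Real.log l)) := by

  have hl0 : 0 < l := lt_trans (by positivity) hl1
  have hρ0 : 0 < l ^ n := pow_pos hl0 n
  have hρ1 : l ^ n < 1 := by linarith
  have hlog : n * Real.log l = Real.log (l ^ n) := by rw [Real.log_pow]
  have hlogρ : Real.log (l ^ n) < 0 := Real.log_neg hρ0 hρ1
  have hw : (Fintype.card (Fin n → Bool) : ENNReal) * ((2 : ENNReal) ^ n)⁻¹ ≤ 1 := by
    simp [ENNReal.mul_inv_cancel]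
  refine ⟨?_, ?_, ?_⟩
  · obtain ⟨R, hR0, hR⟩ := exists_ae_norm_le hw (measurable_examplePhi l n) hself hρ0 hρ1
      (psiVal_nonneg hl0.le (fun _ : Fin n => true)) (norm_examplePhi_le hl0.le n)
    have hdiff : ∀ᵐ p ∂μ, |p.1 - p.2| ≤ 2 * R := by
      filter_upwards [hR] with p hp
      have h1 : |p.1| ≤ ‖p‖ := norm_fst_le p
      have h2 : |p.2| ≤ ‖p‖ := norm_snd_le p
      linarith [abs_sub p.1 p.2]
    have hmain : D ≤ Real.log (3 / l ^ n) / (-Real.log (l ^ n)) := by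
      refine dim_le_of_covers (a := 2) (C := (2 * R + 3) * (4 * R + 3)) hρ0 hρ1 two_pos
        (by positivity) (fun k => ?_) hdim
      obtain ⟨ι, F, Q, hF, hFQ, hQ⟩ := exists_cells hR0 (pow_pos hρ0 k)
        (pow_le_one₀ hρ0.le hρ1.le) hR (ae_near_cantorCenters hl0.le hself hdiff k)
      refine ⟨ι, F, Q, hF.trans ?_, hFQ, hQ⟩
      rw [div_pow]
      gcongr
      exact_mod_cast card_cantorCenters_le _ _ k
    refine hmain.trans_eq ?_
    rw [hlog, Real.log_div (by norm_num) hρ0.ne', sub_eq_neg_add, add_div,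
      div_self (neg_ne_zero.2 hlogρ.ne)]
  · have h3 : Real.log (l ^ n) < -Real.log 3 := by
      rw [← Real.log_inv]
      exact Real.log_lt_log hρ0 (by rwa [one_div] at hln)
    have : Real.log 3 / (-(n * Real.log l)) < 1 := by
      rw [hlog, div_lt_one (by linarith)]
      linarith
    linarith
  · have h2 : -(Real.log 2 / 2) < Real.log l := by
      have := Real.log_lt_log (by positivity) hl1
      rwa [one_div, Real.log_inv, Real.log_sqrt (by norm_num)] at this
    have hneg : Real.log l < 0 := Real.log_neg hl0 hl2
    rw [eq_comm, min_eq_left_iff, le_div_iff₀ (by linarith)]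
    linarith
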